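/- The following definite integral identity holds: ∫ from 0 to π of 1 / (1 + exp(1 + v * cot v) * sin(v)/v) dv = π/2. -/

import Mathlib

open Real

/-- The modulus of `exp z / z` along the curve on which it is real, parametrized by argument. -/
noncomputable def cotKernel (v : ℝ) : ℝ := Real.exp (v * Real.cot v) * Real.sinc v

lemma measurable_cotKernel : Measurable cotKernel := by
  unfold cotKernel
  simp only [Real.cot_eq_cos_div_sin]
  have := continuous_sinc.measurable
  fun_prop

lemma sinc_pos_of_mem_Ioo {v : ℝ} (hv : v ∈ Set.Ioo 0 π) : 0 < sinc v := by
  rw [sinc_of_ne_zero hv.1.ne']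
  exact div_pos (sin_pos_of_mem_Ioo hv) hv.1

lemma cotKernel_pos {v : ℝ} (hv : v ∈ Set.Ioo 0 π) : 0 < cotKernel v :=
  mul_pos (exp_pos _) (sinc_pos_of_mem_Ioo hv)

lemma mul_cot_le_one {v : ℝ} (hv : v ∈ Set.Ioo 0 π) : v * Real.cot v ≤ 1 := by
  have hs := sin_pos_of_mem_Ioo hv
  rw [Real.cot_eq_cos_div_sin, ← mul_div_assoc, div_le_one hs]
  rcases lt_or_ge v (π / 2) with h | h
  · have hc : 0 < cos v := cos_pos_of_mem_Ioo ⟨by linarith [hv.1, pi_pos], h⟩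
    have := lt_tan hv.1 h
    rw [tan_eq_sin_div_cos, lt_div_iff₀ hc] at this
    exact this.le
  · have hc : cos v ≤ 0 := cos_nonpos_of_pi_div_two_le_of_le h (by linarith [hv.2, pi_pos])
    nlinarith [hv.1]

lemma cotKernel_le {v : ℝ} (hv : v ∈ Set.Ioo 0 π) : cotKernel v ≤ Real.exp 1 := by
  have h1 := exp_le_exp.2 (mul_cot_le_one hv)
  have := sinc_le_one v
  have := (sinc_pos_of_mem_Ioo hv).le
  unfold cotKernel
  nlinarith [exp_pos 1, exp_pos (v * Real.cot v)]

lemma ae_mem_Ioo_of_mem_uIoc {a b : ℝ} (hab : a ≤ b) :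
    ∀ᵐ v : ℝ, v ∈ Set.uIoc a b → v ∈ Set.Ioo a b := by
  filter_upwards [MeasureTheory.Measure.ae_ne MeasureTheory.volume b] with v hv h
  rw [Set.uIoc_of_le hab] at h
  exact ⟨h.1, lt_of_le_of_ne h.2 hv⟩

lemma intervalIntegrable_of_bounded_on_Ioo {E : Type*} [NormedAddCommGroup E] {f : ℝ → E}
    {a b C : ℝ} (hab : a ≤ b) (hf : MeasureTheory.AEStronglyMeasurable f)
    (hC : ∀ v ∈ Set.Ioo a b, ‖f v‖ ≤ C) :
    IntervalIntegrable f MeasureTheory.volume a b := by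
  rw [intervalIntegrable_iff_integrableOn_Ioo_of_le hab]
  refine MeasureTheory.Measure.integrableOn_of_bounded (M := C) (by simp) hf ?_
  filter_upwards [MeasureTheory.ae_restrict_mem measurableSet_Ioo] with v hv using hC v hv

/-- The curve `log (v / sin v) + i v`, on which `exp ζ - ζ` is real. -/
noncomputable def realCurve (v : ℝ) : ℂ := ((-Real.log (sinc v) : ℝ) : ℂ) + v * Complex.I

lemma exp_realCurve_sub {v : ℝ} (hv : v ∈ Set.Ioo 0 π) (n : ℕ) :
    Complex.exp (n * (Complex.exp (realCurve v) - realCurve v)) = ((cotKernel v ^ n : ℝ) : ℂ) := by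
  have hs := sin_pos_of_mem_Ioo hv
  have hp := sinc_pos_of_mem_Ioo hv
  have hsc : (Complex.sin v) ≠ 0 := by exact_mod_cast hs.ne'
  have hvc : (v : ℂ) ≠ 0 := by exact_mod_cast hv.1.ne'
  have h1 : Complex.exp (realCurve v) = ((v * Real.cot v : ℝ) : ℂ) + v * Complex.I := by
    rw [realCurve, Complex.exp_add, ← Complex.ofReal_exp, Real.exp_neg, Real.exp_log hp,
      Complex.exp_mul_I, sinc_of_ne_zero hv.1.ne', Real.cot_eq_cos_div_sin]
    push_cast
    field_simp
  have h2 : Complex.exp (realCurve v) - realCurve v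
      = ((v * Real.cot v + Real.log (sinc v) : ℝ) : ℂ) := by
    rw [h1, realCurve]; push_cast; ring
  rw [Complex.exp_nat_mul, h2, ← Complex.ofReal_exp, Real.exp_add, Real.exp_log hp]
  simp [cotKernel]

lemma hasDerivAt_realCurve {v : ℝ} (hv : v ∈ Set.Ioo 0 π) :
    ∃ ρ : ℝ, HasDerivAt realCurve (ρ + Complex.I) v := by
  have hd : DifferentiableAt ℝ (fun x => -Real.log (sinc x)) v := by
    have h0 : DifferentiableAt ℝ (fun x => Real.sin x / x) v :=
      differentiableAt_sin.div differentiableAt_id hv.1.ne'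
    have h1 : DifferentiableAt ℝ sinc v := by
      refine h0.congr_of_eventuallyEq ?_
      filter_upwards [isOpen_ne.mem_nhds hv.1.ne'] with x hx using sinc_of_ne_zero hx
    exact (h1.log (sinc_pos_of_mem_Ioo hv).ne').neg
  refine ⟨_, hd.hasDerivAt.ofReal_comp.add ?_⟩
  simpa using (hasDerivAt_id v).ofReal_comp.mul_const Complex.I

lemma norm_exp_nat_mul_exp_sub_le_one {z : ℂ} (n : ℕ) (h0 : 0 ≤ z.re)
    (h1 : π / 2 ≤ z.im) (h2 : z.im ≤ π) : ‖Complex.exp (n * (Complex.exp z - z))‖ ≤ 1 := by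
  rw [Complex.norm_exp, Real.exp_le_one_iff]
  have hc : cos z.im ≤ 0 := cos_nonpos_of_pi_div_two_le_of_le h1 (by linarith [pi_pos])
  have : (Complex.exp z - z).re ≤ 0 := by
    rw [Complex.sub_re, Complex.exp_re]
    nlinarith [exp_pos z.re]
  rw [← Complex.ofReal_natCast, Complex.re_ofReal_mul]
  exact mul_nonpos_of_nonneg_of_nonpos n.cast_nonneg this

lemma integral_cotKernel_pow_eq (n : ℕ) :
    ∫ v in (0:ℝ)..π, cotKernel v ^ n =
      ∫ θ in (0:ℝ)..π,
        (Complex.exp (n * (Complex.exp (θ * Complex.I) - θ * Complex.I))).re := by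
  have hent : Differentiable ℂ fun z : ℂ => Complex.exp (n * (Complex.exp z - z)) := by fun_prop
  obtain ⟨Φ, hΦ⟩ := hent.isExactOn_univ
  replace hΦ : ∀ z, HasDerivAt Φ (Complex.exp (n * (Complex.exp z - z))) z :=
    fun z => hΦ z (Set.mem_univ z)
  have hcΦ : Continuous Φ := continuous_iff_continuousAt.2 fun z => (hΦ z).continuousAt
  have him : ∀ {f : ℝ → ℂ} {f' : ℂ} {x : ℝ}, HasDerivAt f f' x →
      HasDerivAt (fun y => (f y).im) f'.im x := fun h =>
    (Complex.imCLM.hasFDerivAt.comp_hasDerivAt _ h)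
  have hvert : ∫ θ in (0:ℝ)..π,
      (Complex.exp (n * (Complex.exp (θ * Complex.I) - θ * Complex.I))).re
        = (Φ (π * Complex.I)).im - (Φ 0).im := by
    have := intervalIntegral.integral_eq_sub_of_hasDerivAt (a := 0) (b := π)
      (f := fun θ : ℝ => (Φ (θ * Complex.I)).im)
      (f' := fun θ : ℝ => (Complex.exp (n * (Complex.exp (θ * Complex.I) - θ * Complex.I))).re)
      (fun θ _ => by
        have hl : HasDerivAt (fun θ : ℝ => (θ : ℂ) * Complex.I) Complex.I θ := by
          simpa using (hasDerivAt_id θ).ofReal_comp.mul_const Complex.I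
        simpa using him ((hΦ _).comp θ hl))
      (Continuous.intervalIntegrable (by fun_prop) _ _)
    simpa using this
  have hhor : ∀ ρ : ℝ, (Φ (ρ + π * Complex.I)).im = (Φ (π * Complex.I)).im := by
    have hd : ∀ ρ : ℝ, HasDerivAt (fun ρ : ℝ => (Φ (ρ + π * Complex.I)).im) 0 ρ := by
      intro ρ
      have hl : HasDerivAt (fun ρ : ℝ => (ρ : ℂ) + π * Complex.I) 1 ρ := by
        simpa using (hasDerivAt_id ρ).ofReal_comp.add_const (π * Complex.I)
      have h := him ((hΦ _).comp ρ hl)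
      have : Complex.exp (n * (Complex.exp (ρ + π * Complex.I) - (ρ + π * Complex.I)))
          = (((Real.exp (-Real.exp ρ - ρ) * (-1)) ^ n : ℝ) : ℂ) := by
        rw [Complex.exp_nat_mul, Complex.exp_add, Complex.exp_pi_mul_I]
        rw [show Complex.exp ρ * -1 - (ρ + π * Complex.I)
          = (-Complex.exp ρ - ρ) + -(π * Complex.I) by ring, Complex.exp_add, Complex.exp_neg (_ * _),
          Complex.exp_pi_mul_I]
        push_cast
        norm_num
      rw [mul_one, this, Complex.ofReal_im] at h
      exact h
    intro ρ
    have := is_const_of_deriv_eq_zero (fun x => (hd x).differentiableAt)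
      (fun x => (hd x).deriv) ρ 0
    simpa using this
  rw [hvert]
  refine intervalIntegral.integral_eq_sub_of_hasDerivAt_of_tendsto pi_pos
    (f := fun v => (Φ (realCurve v)).im) ?_ ?_ ?_ ?_
  · intro v hv
    obtain ⟨ρ, hρ⟩ := hasDerivAt_realCurve hv
    have := him ((hΦ _).comp v hρ)
    rw [exp_realCurve_sub hv, Complex.im_ofReal_mul] at this
    simpa using this
  · refine intervalIntegrable_of_bounded_on_Ioo pi_pos.le
      (measurable_cotKernel.pow_const n).aestronglyMeasurable (C := Real.exp 1 ^ n) ?_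
    intro v hv
    rw [norm_pow, Real.norm_of_nonneg (cotKernel_pos hv).le]
    exact pow_le_pow_left₀ (cotKernel_pos hv).le (cotKernel_le hv) n
  · have hc : ContinuousAt realCurve 0 := by
      unfold realCurve
      have := continuous_sinc.continuousAt (x := 0)
      have h := this.log (by simp)
      fun_prop
    have h0 : realCurve 0 = 0 := by simp [realCurve]
    have : ContinuousAt (fun v => (Φ (realCurve v)).im) 0 :=
      (Complex.continuous_im.comp hcΦ).continuousAt.comp hc
    have := this.tendsto
    rw [h0] at this
    exact this.mono_left nhdsWithin_le_nhds
  · rw [tendsto_iff_norm_sub_tendsto_zero]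
    refine squeeze_zero' (g := fun v => π - v) (Filter.Eventually.of_forall fun _ => norm_nonneg _)
      ?_ ?_
    · filter_upwards [Ioo_mem_nhdsLT (show π / 2 < π by linarith [pi_pos])] with v hv
      have hv0 : v ∈ Set.Ioo 0 π := ⟨by linarith [hv.1, pi_pos], hv.2⟩
      set ρ : ℝ := -Real.log (sinc v) with hρdef
      have hρ : 0 ≤ ρ := by
        have := Real.log_nonpos (sinc_pos_of_mem_Ioo hv0).le (sinc_le_one v)
        linarith
      have hz : realCurve v = ρ + v * Complex.I := rfl
      rw [← hhor ρ, ← Complex.sub_im, Real.norm_eq_abs, hz]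
      refine (Complex.abs_im_le_norm _).trans ?_
      have hconv : Convex ℝ {z : ℂ | 0 ≤ z.re ∧ π / 2 ≤ z.im ∧ z.im ≤ π} :=
        (convex_halfSpace_re_ge 0).inter
          ((convex_halfSpace_im_ge (π / 2)).inter (convex_halfSpace_im_le π))
      have := hconv.norm_image_sub_le_of_norm_hasDerivWithin_le (f := Φ) (C := 1)
        (x := ρ + π * Complex.I) (y := ρ + v * Complex.I)
        (fun z _ => (hΦ z).hasDerivWithinAt)
        (fun z hz => norm_exp_nat_mul_exp_sub_le_one n hz.1 hz.2.1 hz.2.2)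
        (by simpa using ⟨hρ, by linarith [pi_pos]⟩) (by simpa using ⟨hρ, hv.1.le, hv.2.le⟩)
      refine this.trans (le_of_eq ?_)
      rw [one_mul, show (ρ + v * Complex.I - (ρ + π * Complex.I) : ℂ)
        = ((v - π : ℝ) : ℂ) * Complex.I by push_cast; ring]
      simp only [norm_mul, Complex.norm_I, mul_one, Complex.norm_real, Real.norm_eq_abs]
      rw [abs_of_neg (by linarith [hv.2])]; ring
    · have : Filter.Tendsto (fun v : ℝ => π - v) (nhds π) (nhds (π - π)) :=
        (continuous_const.sub continuous_id).tendsto π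
      rw [sub_self] at this
      exact this.mono_left nhdsWithin_le_nhds

lemma integral_re_exp_mul_exp_sub (n : ℕ) :
    ∫ θ in (0:ℝ)..π, (Complex.exp (n * (Complex.exp (θ * Complex.I) - θ * Complex.I))).re
      = π * ((n : ℝ) ^ n / n.factorial) := by
  have hsum : ∀ θ : ℝ, HasSum (fun k : ℕ => (n : ℝ) ^ k / k.factorial * cos (((k : ℝ) - n) * θ))
      (Complex.exp (n * (Complex.exp (θ * Complex.I) - θ * Complex.I))).re := by
    intro θ
    have h1 := NormedSpace.expSeries_div_hasSum_exp (𝔸 := ℂ) (n * Complex.exp (θ * Complex.I))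
    rw [← Complex.exp_eq_exp_ℂ] at h1
    have h2 := Complex.hasSum_re (h1.mul_right (Complex.exp (-(n * (θ * Complex.I)))))
    rw [← Complex.exp_add] at h2
    convert h2 using 1
    · ext k
      rw [mul_pow, ← Complex.exp_nat_mul, mul_div_right_comm, mul_assoc, ← Complex.exp_add,
        show (k * (θ * Complex.I) + -(n * (θ * Complex.I)) : ℂ)
          = ((((k : ℝ) - n) * θ : ℝ) : ℂ) * Complex.I by push_cast; ring,
        show ((n : ℂ) ^ k / (k.factorial : ℂ)) = (((n : ℝ) ^ k / k.factorial : ℝ) : ℂ) by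
          push_cast; rfl,
        Complex.re_ofReal_mul, Complex.exp_ofReal_mul_I_re]
    · ring_nf
  have hint : HasSum
      (fun k : ℕ => ∫ θ in (0:ℝ)..π, (n : ℝ) ^ k / k.factorial * cos (((k : ℝ) - n) * θ))
      (∫ θ in (0:ℝ)..π, (Complex.exp (n * (Complex.exp (θ * Complex.I) - θ * Complex.I))).re) := by
    refine intervalIntegral.hasSum_integral_of_dominated_convergence
      (fun k _ => (n : ℝ) ^ k / k.factorial)
      (fun k => (Continuous.aestronglyMeasurable (by fun_prop))) ?_ ?_ ?_ ?_
    · refine fun k => Filter.Eventually.of_forall fun θ _ => ?_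
      rw [norm_mul, Real.norm_of_nonneg (by positivity)]
      exact mul_le_of_le_one_right (by positivity) (abs_cos_le_one _)
    · exact Filter.Eventually.of_forall fun θ _ => Real.summable_pow_div_factorial n
    · simp
    · exact Filter.Eventually.of_forall fun θ _ => hsum θ
  refine hint.unique ?_
  convert hasSum_single n ?_ using 1
  · simp [mul_div_assoc]
  · intro k hk
    have hne : ((k : ℝ) - n) ≠ 0 := sub_ne_zero.2 (by exact_mod_cast hk)
    rw [intervalIntegral.integral_const_mul, intervalIntegral.integral_comp_mul_left _ hne,
      integral_cos]
    have : sin (((k : ℝ) - n) * π) = 0 := by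
      have := sin_int_mul_pi ((k : ℤ) - n)
      push_cast at this
      exact this
    simp [this]

lemma sum_antidiagonal_neg_one_pow_mul_pow (m : ℕ) :
    ∑ p ∈ Finset.HasAntidiagonal.antidiagonal m,
      (-1 : ℝ) ^ p.1 * ((p.1 : ℝ) ^ m / (p.1.factorial * p.2.factorial)) = (-1) ^ m := by
  have h := congrFun (fwdDiff_iter_eq_factorial (R := ℝ) (n := m)) 0
  rw [fwdDiff_iter_eq_sum_shift] at h
  simp only [zero_add, nsmul_eq_mul, mul_one, zsmul_eq_mul] at h
  rw [Finset.Nat.sum_antidiagonal_eq_sum_range_succ_mk]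
  have hm : (m.factorial : ℝ) ≠ 0 := by exact_mod_cast m.factorial_ne_zero
  apply mul_left_cancel₀ hm
  calc _ = (-1) ^ m * ∑ k ∈ Finset.range (m + 1),
        (((-1) ^ (m - k) * (m.choose k : ℤ) : ℤ) : ℝ) * (k : ℝ) ^ m := by
        rw [Finset.mul_sum, Finset.mul_sum]
        refine Finset.sum_congr rfl fun k hk => ?_
        have hk : k ≤ m := Nat.lt_succ_iff.1 (Finset.mem_range.1 hk)
        have hs : (-1 : ℝ) ^ k = (-1) ^ m * (-1) ^ (m - k) := by
          rw [← pow_add, show m + (m - k) = k + 2 * (m - k) by omega, pow_add, pow_mul]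
          simp
        push_cast
        rw [Nat.cast_choose ℝ hk, hs]
        ring
    _ = _ := by
        rw [h]
        simp [mul_comm]

lemma pow_self_div_factorial_le_exp (n : ℕ) : (n : ℝ) ^ n / n.factorial ≤ Real.exp 1 ^ n := by
  rw [← Real.exp_nat_mul, mul_one]
  exact Real.pow_div_factorial_le_exp _ n.cast_nonneg n

lemma hasSum_neg_mul_exp_pow_mul {u : ℝ} (hu : 0 < u)
    (hu' : u * Real.exp u * Real.exp 1 < 1) (hu1 : u < 1) :
    HasSum (fun n : ℕ => (-(u * Real.exp u)) ^ n * ((n : ℝ) ^ n / n.factorial)) (1 + u)⁻¹ := by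
  set f : ℕ × ℕ → ℝ := fun p =>
    (-u) ^ p.1 * ((p.1 : ℝ) ^ p.1 / p.1.factorial) * ((p.1 * u) ^ p.2 / p.2.factorial) with hf
  have hrow : ∀ (n : ℕ) (c : ℝ), HasSum (fun k : ℕ => c * ((n * u) ^ k / k.factorial))
      (c * Real.exp u ^ n) := by
    intro n c
    have := NormedSpace.expSeries_div_hasSum_exp (𝔸 := ℝ) (n * u)
    rw [← Real.exp_eq_exp_ℝ, Real.exp_nat_mul] at this
    exact this.mul_left c
  have habs : ∀ p, ‖f p‖ =
      u ^ p.1 * ((p.1 : ℝ) ^ p.1 / p.1.factorial) * ((p.1 * u) ^ p.2 / p.2.factorial) := by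
    intro p
    simp only [hf]
    rw [norm_mul, norm_mul, norm_pow, norm_neg, Real.norm_of_nonneg hu.le,
      Real.norm_of_nonneg (by positivity), Real.norm_of_nonneg (by positivity)]
  have hsf : Summable f := by
    refine Summable.of_norm ?_
    rw [summable_prod_of_nonneg fun p => norm_nonneg _]
    simp only [habs]
    refine ⟨fun n => (hrow n _).summable, ?_⟩
    simp only [fun n : ℕ => (hrow n (u ^ n * ((n : ℝ) ^ n / n.factorial))).tsum_eq]
    refine Summable.of_nonneg_of_le (fun n => by positivity) (fun n => ?_)
      (summable_geometric_of_lt_one (by positivity) hu')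
    rw [mul_pow, mul_pow, mul_right_comm]
    exact mul_le_mul_of_nonneg_left (pow_self_div_factorial_le_exp n) (by positivity)
  have hdiag : HasSum (fun m : ℕ => (-u) ^ m) (∑' p, f p) := by
    have h := (Finset.HasAntidiagonal.sigmaAntidiagonalEquivProd.hasSum_iff).2 hsf.hasSum
    have h2 := h.sigma (fun m => hasSum_fintype _)
    convert h2 using 1
    ext m
    rw [neg_pow, ← sum_antidiagonal_neg_one_pow_mul_pow, Finset.sum_mul, ← Finset.sum_finset_coe]
    refine Finset.sum_congr rfl fun p _ => ?_
    obtain ⟨⟨a, b⟩, hp⟩ := p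
    have hp' : a + b = m := by simpa using hp
    subst hp'
    simp only [hf, Function.comp, Finset.HasAntidiagonal.sigmaAntidiagonalEquivProd_apply]
    rw [neg_pow u, mul_pow, pow_add, pow_add]
    field_simp
  have htot : ∑' p, f p = (1 + u)⁻¹ := by
    refine hdiag.unique ?_
    have := hasSum_geometric_of_abs_lt_one (r := -u) (by rw [abs_neg, abs_of_pos hu]; exact hu1)
    simpa using this
  have := hsf.hasSum.prod_fiberwise fun n => hrow n ((-u) ^ n * ((n : ℝ) ^ n / n.factorial))
  rw [htot] at this
  convert this using 1
  ext n
  rw [← neg_mul, mul_pow]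
  ring

lemma one_le_norm_one_add_mul {s : ℂ} (hs : 0 < s.re) {g : ℝ} (hg : 0 ≤ g) :
    1 ≤ ‖1 + s * g‖ := by
  refine le_trans ?_ (Complex.re_le_norm _)
  simp only [Complex.add_re, Complex.one_re, Complex.re_mul_ofReal]
  nlinarith

lemma differentiableOn_integral_inv_one_add_mul_cotKernel :
    DifferentiableOn ℂ (fun s : ℂ => ∫ v in (0:ℝ)..π, (1 + s * (cotKernel v : ℂ))⁻¹)
      {s : ℂ | 0 < s.re} := by
  intro s₀ hs₀
  have hopen : IsOpen {s : ℂ | 0 < s.re} := isOpen_lt continuous_const Complex.continuous_re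
  have hm : Measurable fun v => (cotKernel v : ℂ) :=
    Complex.measurable_ofReal.comp measurable_cotKernel
  have hae := ae_mem_Ioo_of_mem_uIoc pi_pos.le
  have hF : ∀ s : ℂ, Measurable fun v => (1 + s * (cotKernel v : ℂ))⁻¹ := fun s => by fun_prop
  have h := intervalIntegral.hasDerivAt_integral_of_dominated_loc_of_deriv_le
    (μ := MeasureTheory.volume) (a := 0) (b := π) (x₀ := s₀) (bound := fun _ => Real.exp 1)
    (F := fun (s : ℂ) v => (1 + s * (cotKernel v : ℂ))⁻¹)
    (F' := fun (s : ℂ) v => -(cotKernel v : ℂ) / (1 + s * (cotKernel v : ℂ)) ^ 2)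
    (hopen.mem_nhds hs₀) (Filter.Eventually.of_forall fun s => (hF s).aestronglyMeasurable)
    ?_ ?_ ?_ ?_ ?_
  · exact h.2.differentiableAt.differentiableWithinAt
  · refine intervalIntegrable_of_bounded_on_Ioo (C := 1) pi_pos.le
      (hF s₀).aestronglyMeasurable fun v hv => ?_
    rw [norm_inv]
    exact inv_le_one_of_one_le₀ (one_le_norm_one_add_mul hs₀ (cotKernel_pos hv).le)
  · exact Measurable.aestronglyMeasurable (by fun_prop)
  · filter_upwards [hae] with v hv hv' s hs
    have hv := hv hv'
    rw [norm_div, norm_neg, norm_pow, Complex.norm_real, Real.norm_of_nonneg (cotKernel_pos hv).le]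
    exact (div_le_self (cotKernel_pos hv).le
      (one_le_pow₀ (one_le_norm_one_add_mul hs (cotKernel_pos hv).le))).trans (cotKernel_le hv)
  · simp
  · filter_upwards [hae] with v hv hv' s hs
    have h1 := one_le_norm_one_add_mul hs (cotKernel_pos (hv hv')).le
    have hne : 1 + s * (cotKernel v : ℂ) ≠ 0 := norm_pos_iff.1 (by linarith)
    have : HasDerivAt (fun s : ℂ => 1 + s * (cotKernel v : ℂ)) (cotKernel v : ℂ) s := by
      simpa using ((hasDerivAt_id s).mul_const (cotKernel v : ℂ)).const_add 1
    exact this.inv hne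

lemma analyticOnNhd_integral_inv_one_add_mul_cotKernel :
    AnalyticOnNhd ℝ (fun s : ℝ => ∫ v in (0:ℝ)..π, (1 + s * cotKernel v)⁻¹) (Set.Ioi 0) := by
  intro s hs
  have hopen : IsOpen {s : ℂ | 0 < s.re} := isOpen_lt continuous_const Complex.continuous_re
  have h := (differentiableOn_integral_inv_one_add_mul_cotKernel.analyticOnNhd hopen (s : ℂ)
    (by simpa using hs)).re_ofReal
  convert h using 2 with t
  rw [← Complex.ofReal_re (∫ v in (0:ℝ)..π, (1 + t * cotKernel v)⁻¹),
    ← intervalIntegral.integral_ofReal]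
  simp

lemma integral_cotKernel_pow (n : ℕ) :
    ∫ v in (0:ℝ)..π, cotKernel v ^ n = π * ((n : ℝ) ^ n / n.factorial) :=
  (integral_cotKernel_pow_eq n).trans (integral_re_exp_mul_exp_sub n)

lemma integral_inv_one_add_mul_exp_mul_cotKernel_of_small {u : ℝ} (hu : 0 < u)
    (hu' : u * Real.exp u * Real.exp 1 < 1) (hu1 : u < 1) :
    ∫ v in (0:ℝ)..π, (1 + u * Real.exp u * cotKernel v)⁻¹ = π * (1 + u)⁻¹ := by
  set s := u * Real.exp u with hs
  have hs0 : 0 < s := by positivity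
  have hae := ae_mem_Ioo_of_mem_uIoc pi_pos.le
  have hbd : ∀ v ∈ Set.Ioo 0 π, |-(s * cotKernel v)| ≤ s * Real.exp 1 := fun v hv => by
    rw [abs_neg, abs_of_pos (mul_pos hs0 (cotKernel_pos hv))]
    exact mul_le_mul_of_nonneg_left (cotKernel_le hv) hs0.le
  have hint : HasSum (fun n : ℕ => ∫ v in (0:ℝ)..π, (-(s * cotKernel v)) ^ n)
      (∫ v in (0:ℝ)..π, (1 + s * cotKernel v)⁻¹) := by
    refine intervalIntegral.hasSum_integral_of_dominated_convergence
      (fun n _ => (s * Real.exp 1) ^ n) (fun n => ?_) (fun n => ?_) ?_ (by simp) ?_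
    · have := measurable_cotKernel
      exact Measurable.aestronglyMeasurable (by fun_prop)
    · filter_upwards [hae] with v hv hv'
      rw [norm_pow]
      exact pow_le_pow_left₀ (norm_nonneg _) (hbd v (hv hv')) n
    · exact Filter.Eventually.of_forall fun v _ =>
        summable_geometric_of_lt_one (by positivity) hu'
    · filter_upwards [hae] with v hv hv'
      simpa using hasSum_geometric_of_abs_lt_one ((hbd v (hv hv')).trans_lt hu')
  refine hint.unique ?_
  have hterm : ∀ n : ℕ, ∫ v in (0:ℝ)..π, (-(s * cotKernel v)) ^ n
      = π * ((-s) ^ n * ((n : ℝ) ^ n / n.factorial)) := fun n => by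
    simp_rw [← neg_mul, mul_pow]
    rw [intervalIntegral.integral_const_mul, integral_cotKernel_pow]
    ring
  simp_rw [hterm]
  exact (hasSum_neg_mul_exp_pow_mul hu hu' hu1).mul_left π

lemma integral_inv_one_add_mul_exp_mul_cotKernel {u : ℝ} (hu : 0 < u) :
    ∫ v in (0:ℝ)..π, (1 + u * Real.exp u * cotKernel v)⁻¹ = π * (1 + u)⁻¹ := by
  have hL : AnalyticOnNhd ℝ
      (fun u : ℝ => ∫ v in (0:ℝ)..π, (1 + u * Real.exp u * cotKernel v)⁻¹) (Set.Ioi 0) :=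
    analyticOnNhd_integral_inv_one_add_mul_cotKernel.comp
      (g := fun s : ℝ => ∫ v in (0:ℝ)..π, (1 + s * cotKernel v)⁻¹)
      (f := fun u : ℝ => u * Real.exp u)
      (fun u _ => analyticAt_id.mul analyticAt_rexp)
      (fun u hu => mul_pos hu (exp_pos u))
  have hR : AnalyticOnNhd ℝ (fun u : ℝ => π * (1 + u)⁻¹) (Set.Ioi 0) := fun u hu =>
    analyticAt_const.mul ((analyticAt_const.add analyticAt_id).inv
      (by have : (0:ℝ) < u := hu
          exact (by positivity : (0:ℝ) < 1 + u).ne'))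
  refine hL.eqOn_of_preconnected_of_eventuallyEq hR isPreconnected_Ioi
    (z₀ := 1 / 10) (by norm_num) ?_ hu
  filter_upwards [Ioo_mem_nhds (show (0:ℝ) < 1 / 10 by norm_num)
    (show (1 / 10 : ℝ) < 1 / 8 by norm_num)] with x hx
  refine integral_inv_one_add_mul_exp_mul_cotKernel_of_small hx.1 ?_ (by linarith [hx.2])
  have he := Real.exp_one_lt_d9
  have hx1 : Real.exp x ≤ Real.exp 1 := exp_le_exp.2 (by linarith [hx.2])
  calc x * Real.exp x * Real.exp 1 ≤ (1 / 8) * 2.72 * 2.72 := by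
        have := hx.1
        gcongr <;> linarith [hx.2]
    _ < 1 := by norm_num

/-- Definite integral identity obtained from the Stieltjes representation of
`1/(1+W(x))` at `x = e`. -/
theorem integral_one_div_one_add_exp_cot :
    ∫ v in (0:ℝ)..π, 1 / (1 + Real.exp (1 + v * Real.cot v) * Real.sin v / v)
      = π / 2 := by
  have h := integral_inv_one_add_mul_exp_mul_cotKernel one_pos
  rw [show π * (1 + 1 : ℝ)⁻¹ = π / 2 by ring] at h
  rw [← h]
  refine intervalIntegral.integral_congr_ae ?_
  filter_upwards [ae_mem_Ioo_of_mem_uIoc pi_pos.le] with v hv hv'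
  rw [cotKernel, sinc_of_ne_zero (hv hv').1.ne', Real.exp_add, one_mul, one_div]
  ring
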